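/- Let q be a prime power, F the finite field with q elements, and n ≥ 1. Then Σ_{k=0}^{n} a(n,k,q) · [ (-1)^{n-1} · (∏_{i=1}^{n-1}(1 - q^i)) · q^{k(k-1)/2} · ∏_{j=k}^{n-1}(q^j - 1) ] = ∏_{i=1}^{2n-1}(q^i - 1), where a(n,k,q) is the number of n×n matrices over F of rank k. -/

import Mathlib

open Matrix Finset

noncomputable section

/-- `acount F m s` is the number of `m × m` matrices over `F` of rank `s`. -/
def acount (F : Type*) [Field F] [Fintype F] (m s : ℕ) : ℕ :=
  Nat.card {X : Matrix (Fin m) (Fin m) F // X.rank = s}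

section

open Module

theorem finrank_span_insert_of_notMem {K V : Type*} [DivisionRing K] [AddCommGroup V]
    [Module K V] [FiniteDimensional K V] {s : Set V} {v : V} (hv : v ∉ Submodule.span K s) :
    finrank K (Submodule.span K (insert v s)) = finrank K (Submodule.span K s) + 1 := by
  have hv0 : v ≠ 0 := by
    rintro rfl
    exact hv (zero_mem _)
  have hd : Disjoint (Submodule.span K s) (Submodule.span K {v}) :=
    (Submodule.disjoint_span_singleton' hv0).2 hv
  have h := Submodule.finrank_sup_add_finrank_inf_eq (Submodule.span K s) (Submodule.span K {v})
  rw [hd.eq_bot, finrank_bot, finrank_span_singleton hv0] at h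
  rw [Submodule.span_insert, sup_comm]
  simpa using h

variable {F V : Type*} [Field F] [Fintype F] [AddCommGroup V] [Module F V] [Fintype V]

/-- Adding one vector to a family keeps the rank `r` in `q ^ r` cases and raises it by one in all
the others. -/
theorem sum_finrank_span_insert (w : ℕ → ℤ) (s : Set V) :
    ∑ v : V, w (finrank F (Submodule.span F (insert v s))) =
      (Fintype.card F : ℤ) ^ finrank F (Submodule.span F s) * w (finrank F (Submodule.span F s)) +
      ((Fintype.card F : ℤ) ^ finrank F V - (Fintype.card F : ℤ) ^ finrank F (Submodule.span F s)) *
        w (finrank F (Submodule.span F s) + 1) := by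
  classical
  set W := Submodule.span F s
  have hcard : (#{v : V | v ∈ W} : ℤ) = (Fintype.card F : ℤ) ^ finrank F W := by
    rw [← Fintype.card_subtype]
    exact_mod_cast card_eq_pow_finrank (K := F) (V := W)
  have hcompl : (#{v : V | v ∉ W} : ℤ) =
      (Fintype.card F : ℤ) ^ finrank F V - (Fintype.card F : ℤ) ^ finrank F W := by
    have h := Finset.card_filter_add_card_filter_not (s := (univ : Finset V)) (fun v => v ∈ W)
    rw [card_univ, card_eq_pow_finrank (K := F) (V := V)] at h
    rw [← hcard, eq_sub_iff_add_eq']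
    exact_mod_cast h
  rw [← Finset.sum_filter_add_sum_filter_not univ (fun v => v ∈ W), ← hcompl, ← hcard,
    ← nsmul_eq_mul, ← nsmul_eq_mul, ← sum_const, ← sum_const]
  congr 1
  · refine sum_congr rfl fun v hv => ?_
    rw [Submodule.span_insert_eq_span (by simpa using hv)]
  · refine sum_congr rfl fun v hv => ?_
    rw [finrank_span_insert_of_notMem (by simpa using hv)]

theorem sum_finrank_span_range_succ (w : ℕ → ℤ) (n : ℕ) :
    ∑ f : Fin (n + 1) → V, w (finrank F (Submodule.span F (Set.range f))) =
      ∑ f : Fin n → V,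
        ((Fintype.card F : ℤ) ^ finrank F (Submodule.span F (Set.range f)) *
            w (finrank F (Submodule.span F (Set.range f))) +
          ((Fintype.card F : ℤ) ^ finrank F V -
              (Fintype.card F : ℤ) ^ finrank F (Submodule.span F (Set.range f))) *
            w (finrank F (Submodule.span F (Set.range f)) + 1)) := by
  rw [← (Fin.consEquiv fun _ : Fin (n + 1) => V).sum_comp, Fintype.sum_prod_type_right]
  refine sum_congr rfl fun f _ => ?_
  rw [← sum_finrank_span_insert]
  refine sum_congr rfl fun v _ => ?_
  rw [← Fin.range_cons]
  rfl

theorem sum_finrank_span_range_weight (n s M : ℕ) (h : s + n ≤ M) :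
    ∑ f : Fin n → V,
      (Fintype.card F : ℤ) ^ ((finrank F (Submodule.span F (Set.range f))).choose 2 +
          s * finrank F (Submodule.span F (Set.range f))) *
        ∏ j ∈ Ico (finrank F (Submodule.span F (Set.range f)) + s) M,
          ((Fintype.card F : ℤ) ^ j - 1) =
      (∏ i ∈ range n, ((Fintype.card F : ℤ) ^ (finrank F V + s + i) - 1)) *
        ∏ j ∈ Ico (s + n) M, ((Fintype.card F : ℤ) ^ j - 1) := by
  induction n generalizing s with
  | zero =>
    have hrank (f : Fin 0 → V) : finrank F (Submodule.span F (Set.range f)) = 0 := by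
      rw [Set.range_eq_empty, Submodule.span_empty, finrank_bot]
    simp [hrank]
  | succ n ih =>
    have key := sum_finrank_span_range_succ (F := F) (V := V) (fun r =>
      (Fintype.card F : ℤ) ^ (r.choose 2 + s * r) *
        ∏ j ∈ Ico (r + s) M, ((Fintype.card F : ℤ) ^ j - 1)) n
    refine key.trans ?_
    rw [prod_range_succ', mul_right_comm]
    have ih' := ih (s + 1) (by omega)
    rw [show s + (n + 1) = s + 1 + n by omega]
    simp only [show ∀ i, finrank F V + s + (i + 1) = finrank F V + (s + 1) + i by intros; omega]
    rw [← ih', sum_mul]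
    refine sum_congr rfl fun f _ => ?_
    have hr : finrank F (Submodule.span F (Set.range f)) ≤ n := by
      simpa [Set.finrank] using finrank_range_le_card (R := F) f
    generalize finrank F (Submodule.span F (Set.range f)) = r at hr
    rw [prod_eq_prod_Ico_succ_bot (show r + s < M by omega), Nat.choose_succ_succ' r 1,
      Nat.choose_one_right, show r + 1 + s = r + s + 1 by omega,
      show r + (s + 1) = r + s + 1 by omega]
    ring

end

theorem dimension_verification {q n : ℕ} (hq : IsPrimePow q)
    (F : Type*) [Field F] [Fintype F] (hF : Fintype.card F = q) (hn : 1 ≤ n) :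
    ∑ k ∈ Finset.range (n + 1),
        (acount F n k : ℤ) *
          ((-1 : ℤ) ^ (n - 1) * (∏ i ∈ Finset.Icc 1 (n - 1), (1 - (q : ℤ) ^ i)) *
            (q : ℤ) ^ (k * (k - 1) / 2) * ∏ j ∈ Finset.Ico k n, ((q : ℤ) ^ j - 1)) =
      ∏ i ∈ Finset.Icc 1 (2 * n - 1), ((q : ℤ) ^ i - 1) := by
  classical
  subst hF
  have hsign : (-1 : ℤ) ^ (n - 1) * (∏ i ∈ Icc 1 (n - 1), (1 - (Fintype.card F : ℤ) ^ i)) =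
      ∏ i ∈ Ico 1 n, ((Fintype.card F : ℤ) ^ i - 1) := by
    have h : Icc 1 (n - 1) = Ico 1 n := by ext; simp; omega
    have hc : n - 1 = #(Ico 1 n) := by simp
    rw [h, hc, ← prod_const, ← prod_mul_distrib]
    exact prod_congr rfl fun i _ => by ring
  have hsum (w : ℕ → ℤ) : ∑ k ∈ range (n + 1), (acount F n k : ℤ) * w k =
      ∑ X : Matrix (Fin n) (Fin n) F, w X.rank := by
    rw [← sum_fiberwise_of_maps_to (t := range (n + 1)) (g := Matrix.rank)
      fun X _ => mem_range.2 (Nat.lt_succ_of_le (by simpa using X.rank_le_width))]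
    refine sum_congr rfl fun k _ => ?_
    rw [sum_congr rfl fun X hX => by rw [(mem_filter.1 hX).2], sum_const, nsmul_eq_mul, acount,
      Nat.card_eq_fintype_card, Fintype.card_subtype]
  have hweight := sum_finrank_span_range_weight (F := F) (V := Fin n → F) n 0 n (by simp)
  simp only [hsign, mul_assoc, mul_left_comm _ (∏ i ∈ Ico 1 n, _), ← mul_sum, ← Nat.choose_two_right]
  rw [hsum fun k => (Fintype.card F : ℤ) ^ k.choose 2 *
    ∏ j ∈ Ico k n, ((Fintype.card F : ℤ) ^ j - 1)]
  simp only [zero_mul, add_zero, zero_add, Ico_self, prod_empty, mul_one,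
    Module.finrank_fin_fun] at hweight
  have h2 : Icc 1 (2 * n - 1) = Ico 1 (2 * n) := by ext; simp; omega
  rw [h2, ← prod_Ico_consecutive _ hn (show n ≤ 2 * n by omega),
    prod_Ico_eq_prod_range _ n, show 2 * n - n = n by omega]
  congr 1
  refine Eq.trans ?_ hweight
  refine sum_congr rfl fun X _ => ?_
  rw [Matrix.rank_eq_finrank_span_row]
  rfl
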